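/- Let M and N be submodules of a finitely generated S-module L. Then for almost all α there are canonical isomorphisms of S_α-modules: (L/M)_α ≅ L_α/M_α, (M ∩ N)_α ≅ M_α ∩ N_α, and (M + N)_α ≅ M_α + N_α, where M_α and N_α are identified with submodules of L_α. -/

import Mathlib

set_option maxHeartbeats 1000000
set_option synthInstance.maxHeartbeats 1000000

noncomputable section

namespace Spl

open MvPolynomial

/-- "Q(α) holds for almost all α ∈ K^m", i.e. away from a proper algebraic
subvariety of `K^m`. -/
def AlmostAll (K : Type) [Field K] (m : ℕ) (Q : (Fin m → K) → Prop) : Prop :=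
  ∃ c : MvPolynomial (Fin m) K, c ≠ 0 ∧ ∀ α : Fin m → K, MvPolynomial.eval α c ≠ 0 → Q α

variable (k K : Type) [Field k] [Field K] [Algebra k K]

/-- the field k(u) of rational functions in u = (u_1, ..., u_m) -/
abbrev kU (m : ℕ) := FractionRing (MvPolynomial (Fin m) k)

/-- the polynomial ring R = k(u)[X_1, ..., X_n] -/
abbrev Rg (m n : ℕ) := MvPolynomial (Fin n) (kU k m)

/-- the subfield k(α) ⊆ K generated by α = (α_1, ..., α_m) over k -/
abbrev kA {m : ℕ} (α : Fin m → K) := IntermediateField.adjoin k (Set.range α)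

/-- the polynomial ring R_α = k(α)[X_1, ..., X_n] -/
abbrev Ra {m : ℕ} (n : ℕ) (α : Fin m → K) := MvPolynomial (Fin n) (kA k K α)

/-- evaluation u ↦ α, from k[u] to k(α) -/
def evalα {m : ℕ} (α : Fin m → K) : MvPolynomial (Fin m) k →+* kA k K α :=
  (MvPolynomial.aeval fun i =>
    (⟨α i, IntermediateField.subset_adjoin k (Set.range α) ⟨i, rfl⟩⟩ : kA k K α)).toRingHom

/-- the inclusion k[u][X] → R = k(u)[X] -/
def toR (m n : ℕ) : MvPolynomial (Fin n) (MvPolynomial (Fin m) k) →+* Rg k m n :=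
  MvPolynomial.map (algebraMap (MvPolynomial (Fin m) k) (kU k m))

/-- substitution u ↦ α, from k[u][X] to R_α = k(α)[X] -/
def toRa {m : ℕ} (n : ℕ) (α : Fin m → K) :
    MvPolynomial (Fin n) (MvPolynomial (Fin m) k) →+* Ra k K n α :=
  MvPolynomial.map (evalα k K α)

/-- Krull's specialization I_α = { f(α,X) | f(u,X) ∈ I ∩ k[u,X] } of an ideal I ⊆ R
(as an ideal of R_α, i.e. the ideal spanned by the specialized elements). -/
def idealSpec {m : ℕ} (n : ℕ) (α : Fin m → K) (I : Ideal (Rg k m n)) :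
    Ideal (Ra k K n α) :=
  Ideal.span (toRa k K n α '' { f | toR k m n f ∈ I })

/-- `ElemSpec k K n α f fα` : fα is the specialization of f ∈ R at α, i.e. writing
f = p(u,X)/q(u) with q(α) ≠ 0 one has fα = p(α,X)/q(α). -/
def ElemSpec {m : ℕ} (n : ℕ) (α : Fin m → K) (f : Rg k m n) (fα : Ra k K n α) : Prop :=
  ∃ (p : MvPolynomial (Fin n) (MvPolynomial (Fin m) k)) (q : MvPolynomial (Fin m) k),
    evalα k K α q ≠ 0 ∧
    MvPolynomial.C (algebraMap (MvPolynomial (Fin m) k) (kU k m) q) * f = toR k m n p ∧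
    MvPolynomial.C (evalα k K α q) * fα = toRa k K n α p

variable {k K}

/-- `LocElemSpec P ℘ a aα` : aα ∈ S_α = (R_α)_℘ is the specialization of a ∈ S = R_P,
i.e. writing a = f/g with f, g ∈ R, g ∉ P, one has g_α ∉ ℘ and aα = f_α/g_α. -/
def LocElemSpec {m n : ℕ} {α : Fin m → K} (P : Ideal (Rg k m n)) [P.IsPrime]
    (℘ : Ideal (Ra k K n α)) [℘.IsPrime]
    {S : Type} [CommRing S] [Algebra (Rg k m n) S] [IsLocalization.AtPrime S P]
    {Sα : Type} [CommRing Sα] [Algebra (Ra k K n α) Sα] [IsLocalization.AtPrime Sα ℘]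
    (a : S) (aα : Sα) : Prop :=
  ∃ (f g : Rg k m n) (fα gα : Ra k K n α) (hg : g ∈ P.primeCompl)
    (hgα : gα ∈ ℘.primeCompl),
    ElemSpec k K n α f fα ∧ ElemSpec k K n α g gα ∧
    a = IsLocalization.mk' S f ⟨g, hg⟩ ∧
    aα = IsLocalization.mk' Sα fα ⟨gα, hgα⟩

/-- entrywise specialization of matrices, relative to an element-specialization
relation `E`. -/
def MatSpec {S T : Type} (E : S → T → Prop) {r s : ℕ}
    (A : Matrix (Fin r) (Fin s) S) (B : Matrix (Fin r) (Fin s) T) : Prop :=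
  ∀ i j, E (A i j) (B i j)

/-- the cokernel of the linear map attached to a matrix A, i.e. the module
presented by A. -/
abbrev MatCoker {S : Type} [CommRing S] {r s : ℕ} (A : Matrix (Fin r) (Fin s) S) :=
  (Fin r → S) ⧸ LinearMap.range A.mulVecLin

/-- a finite free presentation F_1 → F_0 → L → 0 of the module L, where the map
F_1 → F_0 is given by the matrix A and the map F_0 → L is π. -/
structure Present (S : Type) [CommRing S] (r s : ℕ) (L : Type) [AddCommGroup L]
    [Module S L] where
  A : Matrix (Fin r) (Fin s) S
  π : (Fin r → S) →ₗ[S] L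
  surj : Function.Surjective π
  ker_eq : LinearMap.ker π = LinearMap.range A.mulVecLin

theorem comm_le {S : Type} [CommRing S] {r s r' s' : ℕ} {B : Matrix (Fin r) (Fin s) S}
    {C : Matrix (Fin r') (Fin s') S} {W : Matrix (Fin r') (Fin r) S}
    {W1 : Matrix (Fin s') (Fin s) S} (h : W * B = C * W1) :
    LinearMap.range B.mulVecLin ≤ (LinearMap.range C.mulVecLin).comap W.mulVecLin := by
  rintro x ⟨y, rfl⟩
  exact ⟨W1.mulVecLin y, by
    simp only [Matrix.mulVecLin_apply, Matrix.mulVec_mulVec, h]⟩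

/-- the map between the modules presented by B and C induced by the matrix W
(a specialization of a lift of a map between the presented modules). -/
def cokerMap {S : Type} [CommRing S] {r s r' s' : ℕ} {B : Matrix (Fin r) (Fin s) S}
    {C : Matrix (Fin r') (Fin s') S} (W : Matrix (Fin r') (Fin r) S)
    (h : LinearMap.range B.mulVecLin ≤ (LinearMap.range C.mulVecLin).comap W.mulVecLin) :
    MatCoker B →ₗ[S] MatCoker C :=
  Submodule.mapQ _ _ W.mulVecLin h

/-- a lift of a homomorphism v : L → M to given finite free presentations of L and M:
a commutative diagram whose vertical maps are given by the matrices V1, V0. -/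
structure MapLift {S : Type} [CommRing S] {rL sL rM sM : ℕ} {L M : Type}
    [AddCommGroup L] [Module S L] [AddCommGroup M] [Module S M]
    (pL : Present S rL sL L) (pM : Present S rM sM M) (v : L →ₗ[S] M) where
  V0 : Matrix (Fin rM) (Fin rL) S
  V1 : Matrix (Fin sM) (Fin sL) S
  comm0 : pM.π ∘ₗ V0.mulVecLin = v ∘ₗ pL.π
  comm1 : V0 * pL.A = pM.A * V1

/-- Krull dimension of a module, dim L = dim S/Ann L. -/
def moduleDim (S : Type) [CommRing S] (L : Type) [AddCommGroup L] [Module S L] :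
    WithBot ℕ∞ :=
  ringKrullDim (S ⧸ Module.annihilator S L)

/-- height of an ideal: the infimum of dim S_p over the primes p ⊇ I. -/
def idealHeight {S : Type} [CommRing S] (I : Ideal S) : WithBot ℕ∞ :=
  sInf { d | ∃ (p : Ideal S) (hp : p.IsPrime), I ≤ p ∧
    d = ringKrullDim (Localization (@Ideal.primeCompl _ _ p hp)) }

/-- length of a module: the longest chain of submodules. -/
def moduleLength (S : Type) [CommRing S] (L : Type) [AddCommGroup L] [Module S L] :
    WithBot ℕ∞ :=
  Order.krullDim (Submodule S L)

/-- grade(𝔞, L) ≥ t : there is an L-regular sequence of length t in 𝔞. -/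
def GradeGE {S : Type} [CommRing S] (𝔞 : Ideal S) (L : Type) [AddCommGroup L]
    [Module S L] (t : ℕ) : Prop :=
  ∃ rs : List S, rs.length = t ∧ (∀ x ∈ rs, x ∈ 𝔞) ∧ RingTheory.Sequence.IsRegular L rs

/-- grade(𝔞, L) : the length of a maximal L-regular sequence in 𝔞. -/
def grade {S : Type} [CommRing S] (𝔞 : Ideal S) (L : Type) [AddCommGroup L]
    [Module S L] : ℕ∞ :=
  sSup { t : ℕ∞ | ∃ t' : ℕ, t = (t' : ℕ∞) ∧ GradeGE 𝔞 L t' }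

/-- depth of a module over a local ring: grade(𝔪, L). -/
def depth (S : Type) [CommRing S] [IsLocalRing S] (L : Type) [AddCommGroup L]
    [Module S L] : ℕ∞ :=
  grade (IsLocalRing.maximalIdeal S) L

/-- proj dim L ≤ d : L admits a finite free resolution of length ≤ d, encoded as a
(possibly infinite) free resolution ⋯ → F_1 → F_0 → L → 0 with F_j = 0 for j > d. -/
def ProjDimLE (S : Type) [CommRing S] (L : Type) [AddCommGroup L] [Module S L]
    (d : ℕ) : Prop :=
  ∃ (r : ℕ → ℕ) (A : ∀ j : ℕ, Matrix (Fin (r j)) (Fin (r (j + 1))) S)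
    (π : (Fin (r 0) → S) →ₗ[S] L),
    Function.Surjective π ∧ LinearMap.ker π = LinearMap.range (A 0).mulVecLin ∧
    (∀ j : ℕ, LinearMap.ker (A j).mulVecLin = LinearMap.range (A (j + 1)).mulVecLin) ∧
    ∀ j : ℕ, d < j → r j = 0

/-- projective dimension of a module, as an extended natural number. -/
def projDim (S : Type) [CommRing S] (L : Type) [AddCommGroup L] [Module S L] : ℕ∞ :=
  sInf { d : ℕ∞ | ∃ d' : ℕ, d = (d' : ℕ∞) ∧ ProjDimLE S L d' }

/-- the i-th local cohomology module H^i_𝔞(L) as a module. -/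
abbrev localCoh {S : Type} [CommRing S] (𝔞 : Ideal S) (i : ℕ) (L : Type)
    [AddCommGroup L] [Module S L] : ModuleCat S :=
  (localCohomology 𝔞 i).obj (ModuleCat.of S L)

/-- the colon submodule (0 :_L 𝔞) = { x ∈ L | 𝔞 x = 0 }. -/
def colonSubmodule {S : Type} [CommRing S] (𝔞 : Ideal S) (L : Type) [AddCommGroup L]
    [Module S L] : Submodule S L where
  carrier := { x | ∀ c ∈ 𝔞, c • x = 0 }
  add_mem' := by
    intro a b ha hb c hc
    rw [smul_add, ha c hc, hb c hc, add_zero]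
  zero_mem' := by
    intro c _
    rw [smul_zero]
  smul_mem' := by
    intro s x hx c hc
    rw [smul_comm, hx c hc, smul_zero]

/-- a (partial) system of parameters: the d = dim L elements a_1, ..., a_d lie in the
maximal ideal and L/(a_1, ..., a_d)L has dimension ≤ 0. -/
def IsSOP (S : Type) [CommRing S] [IsLocalRing S] (L : Type) [AddCommGroup L]
    [Module S L] {d : ℕ} (a : Fin d → S) : Prop :=
  (∀ i, a i ∈ IsLocalRing.maximalIdeal S) ∧
  moduleDim S L = (d : ℕ∞) ∧
  moduleDim S (L ⧸ (Ideal.span (Set.range a) • (⊤ : Submodule S L))) ≤ 0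

/-- a standard system of parameters: (a_1, ..., a_d) H^i_𝔪(L/(a_1, ..., a_j)L) = 0
for all i + j < d. -/
def IsStandardSOP (S : Type) [CommRing S] [IsLocalRing S] (L : Type) [AddCommGroup L]
    [Module S L] {d : ℕ} (a : Fin d → S) : Prop :=
  IsSOP S L a ∧
  ∀ i j : ℕ, i + j < d →
    Ideal.span (Set.range a) ≤ Module.annihilator S
      (localCoh (IsLocalRing.maximalIdeal S) i
        (L ⧸ (Ideal.span (a '' { x : Fin d | (x : ℕ) < j }) • (⊤ : Submodule S L))))

/-- a standard ideal for L: an 𝔪-primary ideal 𝔞 such that every system of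
parameters of L contained in 𝔞 is standard. -/
def IsStandardIdeal (S : Type) [CommRing S] [IsLocalRing S] (L : Type) [AddCommGroup L]
    [Module S L] (𝔞 : Ideal S) : Prop :=
  𝔞.radical = IsLocalRing.maximalIdeal S ∧
  ∀ (d : ℕ) (a : Fin d → S), (∀ i, a i ∈ 𝔞) → IsSOP S L a → IsStandardSOP S L a


/-- Generic purity for ideals. -/
theorem exists_generic_pure_ideal {A : Type*} [CommRing A] [IsDomain A] {n : ℕ}
    (J : Ideal (MvPolynomial (Fin n) A)) :
    ∃ f : A, f ≠ 0 ∧ ∀ q : Ideal A, q.IsPrime → f ∉ q → ∀ x ∈ J, x ∈ q.map C →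
      ∃ s, s ∉ q ∧ C s * x ∈ q.map C * J := by
  let o : MonomialOrder (Fin n) := MonomialOrder.lex
  let Δ : Set (Fin n →₀ ℕ) := {d | ∃ g ∈ J, g ≠ 0 ∧ o.degree g = d}
  have hfin : {d | Minimal (· ∈ Δ) d}.Finite :=
    WellQuasiOrderedLE.finite_of_isAntichain (setOfPred_minimal_antichain _)
  have hch : ∀ d : {d | Minimal (· ∈ Δ) d}, ∃ g ∈ J, g ≠ 0 ∧ o.degree g = d := fun d => d.2.1
  choose g hgJ hg0 hgd using hch
  have := hfin.fintype
  refine ⟨∏ d, o.leadingCoeff (g d), ?_, ?_⟩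
  · exact Finset.prod_ne_zero_iff.mpr fun d _ => o.leadingCoeff_ne_zero_iff.mpr (hg0 d)
  intro q hq hf x
  have hlc : ∀ d, o.leadingCoeff (g d) ∉ q := fun d hd =>
    hf (Ideal.mem_of_dvd _ (Finset.dvd_prod_of_mem _ (Finset.mem_univ d)) hd)
  induction hx : o.toSyn (o.degree x) using WellFoundedLT.induction generalizing x with
  | ind e ih =>
  intro hxJ hxq
  by_cases hx0 : x = 0
  · exact ⟨1, fun h => hq.ne_top (q.eq_top_iff_one.mpr h), by simp [hx0]⟩
  obtain ⟨d, hd, hdm⟩ := exists_minimal_le_of_wellFoundedLT (· ∈ Δ) (o.degree x) ⟨x, hxJ, hx0, rfl⟩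
  set G := g ⟨d, hdm⟩ with hG
  have hGd : o.degree G = d := hgd ⟨d, hdm⟩
  have hsup : o.degree x ⊔ o.degree G = o.degree x := by rw [hGd]; exact sup_eq_left.mpr hd
  have hs : o.sPolynomial x G = C (o.leadingCoeff G) * x
      - monomial (o.degree x - d) (o.leadingCoeff x) * G := by
    rw [MonomialOrder.sPolynomial, hGd, tsub_eq_zero_of_le hd, ← C_apply]
  have hxc : o.leadingCoeff x ∈ q := mem_map_C_iff.mp hxq _
  have hmon : (monomial (o.degree x - d) (o.leadingCoeff x) : MvPolynomial (Fin n) A) ∈ q.map C := by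
    rw [← mul_one (o.leadingCoeff x), ← C_mul_monomial]
    exact Ideal.mul_mem_right _ _ (Ideal.mem_map_of_mem _ hxc)
  have key : ∃ s, s ∉ q ∧ C s * o.sPolynomial x G ∈ q.map C * J := by
    by_cases hs0 : o.sPolynomial x G = 0
    · exact ⟨1, fun h => hq.ne_top (q.eq_top_iff_one.mpr h), by simp [hs0]⟩
    refine ih _ ?_ _ rfl ?_ ?_
    · have := o.degree_sPolynomial_lt_sup_degree hs0
      rwa [hsup, hx] at this
    · rw [hs]
      exact J.sub_mem (J.mul_mem_left _ hxJ) (J.mul_mem_left _ (hgJ _))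
    · rw [hs]
      exact Ideal.sub_mem _ (Ideal.mul_mem_left _ _ hxq) (Ideal.mul_mem_right _ _ hmon)
  obtain ⟨s, hsq, hs'⟩ := key
  refine ⟨s * o.leadingCoeff G, fun h => (hq.mem_or_mem h).elim hsq (hlc _), ?_⟩
  have : C (s * o.leadingCoeff G) * x = C s * o.sPolynomial x G
      + C s * (monomial (o.degree x - d) (o.leadingCoeff x) * G) := by
    rw [hs, C_mul]; ring
  rw [this]
  exact Ideal.add_mem _ hs' (Ideal.mul_mem_left _ _ (Ideal.mul_mem_mul hmon (hgJ _)))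

theorem apply_mem_of_mem_smul {R : Type*} [CommRing R] {ι : Type*} {I : Ideal R}
    {N : Submodule R (ι → R)} {y : ι → R} (hy : y ∈ I • N) (i : ι) : y i ∈ I := by
  induction hy using Submodule.smul_induction_on' with
  | smul r hr z _ => exact I.mul_mem_right _ hr
  | add x _ y _ hx hy => exact I.add_mem hx hy

/-- Generic purity for submodules of a free module. -/
theorem exists_generic_pure_submodule {A : Type*} [CommRing A] [IsDomain A] {n : ℕ} {ι : Type*}
    (T : Finset ι) (N : Submodule (MvPolynomial (Fin n) A) (ι → MvPolynomial (Fin n) A)) :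
    ∃ f : A, f ≠ 0 ∧ ∀ q : Ideal A, q.IsPrime → f ∉ q → ∀ x ∈ N, (∀ i, x i ∈ q.map C) →
      (∀ i ∉ T, x i = 0) →
      ∃ s, s ∉ q ∧ (C s : MvPolynomial (Fin n) A) • x ∈
        (q.map C : Ideal (MvPolynomial (Fin n) A)) • N := by
  classical
  induction T using Finset.induction_on with
  | empty =>
    refine ⟨1, one_ne_zero, fun q hq h1 x _ _ hx => ⟨1, h1, ?_⟩⟩
    have : x = 0 := funext fun i => hx i (Finset.notMem_empty i)
    simp [this]
  | insert a T ha ih =>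
    obtain ⟨f, hf0, hf⟩ := ih
    let W : Submodule (MvPolynomial (Fin n) A) (ι → MvPolynomial (Fin n) A) :=
      N ⊓ ⨅ i ∈ {i | i ∉ insert a T}, LinearMap.ker (LinearMap.proj i)
    obtain ⟨f', hf0', hf'⟩ := exists_generic_pure_ideal (W.map (LinearMap.proj a))
    refine ⟨f * f', mul_ne_zero hf0 hf0', fun q hq hff x hxN hxq hxT => ?_⟩
    have hxW : x ∈ W := by
      refine ⟨hxN, ?_⟩
      simpa [Submodule.mem_iInf] using hxT
    obtain ⟨s, hs, hsx⟩ := hf' q hq (fun h => hff (q.mul_mem_left _ h)) (x a) ⟨x, hxW, rfl⟩ (hxq a)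
    rw [← smul_eq_mul (q.map C), ← Submodule.map_smul''] at hsx
    obtain ⟨y, hy, hya⟩ := hsx
    have hyW : y ∈ W := Submodule.smul_le_right hy
    have hyT : ∀ i ∉ insert a T, y i = 0 := by
      have := hyW.2
      simpa [Submodule.mem_iInf] using this
    have hyq : ∀ i, y i ∈ q.map C := apply_mem_of_mem_smul hy
    obtain ⟨t, ht, htx⟩ := hf q hq (fun h => hff (q.mul_mem_right _ h))
      ((C s : MvPolynomial (Fin n) A) • x - y)
      (N.sub_mem (N.smul_mem _ hxN) hyW.1)
      (fun i => Ideal.sub_mem _ (Ideal.mul_mem_left _ _ (hxq i)) (hyq i)) (fun i hi => by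
        by_cases hia : i = a
        · subst hia
          simpa [sub_eq_zero] using hya.symm
        · have : i ∉ insert a T := by simp [hia, hi]
          simp [hxT i this, hyT i this])
    refine ⟨t * s, fun h => (hq.mem_or_mem h).elim ht hs, ?_⟩
    have : (C (t * s) : MvPolynomial (Fin n) A) • x
        = (C t : MvPolynomial (Fin n) A) • ((C s : MvPolynomial (Fin n) A) • x - y)
          + (C t : MvPolynomial (Fin n) A) • y := by
      rw [C_mul, smul_sub, sub_add_cancel, mul_smul]
    rw [this]
    exact Submodule.add_mem _ htx (Submodule.smul_mem _ _
      (Submodule.smul_mono le_rfl inf_le_left hy))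

/-- Every element of the target is a fraction of values of `ψ`. -/
def HasFracs {R T : Type*} [CommRing R] [CommRing T] (ψ : R →+* T) : Prop :=
  ∀ x : T, ∃ y h : R, IsUnit (ψ h) ∧ ψ h * x = ψ y

theorem HasFracs.exists_common {R T : Type*} [CommRing R] [CommRing T] {ψ : R →+* T}
    (hψ : HasFracs ψ) {ι : Type*} [Finite ι] (x : ι → T) :
    ∃ (y : ι → R) (h : R), IsUnit (ψ h) ∧ ∀ i, ψ h * x i = ψ (y i) := by
  classical
  have := Fintype.ofFinite ι
  choose y h hu hy using fun i => hψ (x i)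
  refine ⟨fun i => (∏ j ∈ Finset.univ.erase i, h j) * y i, ∏ j, h j, ?_, fun i => ?_⟩
  · rw [map_prod]
    exact IsUnit.prod_univ_iff.mpr hu
  · rw [map_mul, ← hy i, ← mul_assoc, ← map_mul, Finset.prod_erase_mul _ _ (Finset.mem_univ i)]

theorem HasFracs.exists_common_matrix {R T : Type*} [CommRing R] [CommRing T] {ψ : R →+* T}
    (hψ : HasFracs ψ) {ι κ : Type*} [Finite ι] [Finite κ] (M : Matrix ι κ T) :
    ∃ (M' : Matrix ι κ R) (h : R), IsUnit (ψ h) ∧ ∀ i j, ψ h * M i j = ψ (M' i j) := by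
  obtain ⟨y, h, hu, hy⟩ := hψ.exists_common (fun p : ι × κ => M p.1 p.2)
  exact ⟨fun i j => y (i, j), h, hu, fun i j => hy (i, j)⟩

/-- Linear implications `D x = 0 → E x ∈ im F` between matrices. -/
def LinImp {T : Type*} [CommRing T] {d a e c : Type*} [Fintype a] [Fintype c]
    (D : Matrix d a T) (E : Matrix e a T) (F : Matrix e c T) : Prop :=
  ∀ x, D.mulVec x = 0 → ∃ y, F.mulVec y = E.mulVec x

theorem LinImp.of_smul {T : Type*} [CommRing T] {d a e c : Type*} [Fintype a] [Fintype c]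
    {D D' : Matrix d a T} {E E' : Matrix e a T} {F F' : Matrix e c T} {u v w : T}
    (hv : IsUnit v) (hD : D' = u • D) (hE : E' = v • E) (hF : F' = w • F)
    (h : LinImp D' E' F') : LinImp D E F := by
  subst hD hE hF
  intro x hx
  obtain ⟨y, hy⟩ := h x (by rw [Matrix.smul_mulVec, hx, smul_zero])
  obtain ⟨v', hv'⟩ := hv.exists_left_inv
  refine ⟨(v' * w) • y, ?_⟩
  rw [Matrix.smul_mulVec, Matrix.smul_mulVec] at hy
  rw [Matrix.mulVec_smul, mul_smul, hy, smul_smul, hv', one_smul]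

theorem LinImp.smul {T : Type*} [CommRing T] {d a e c : Type*} [Fintype a] [Fintype c]
    {D D' : Matrix d a T} {E E' : Matrix e a T} {F F' : Matrix e c T} {u v w : T}
    (hu : IsUnit u) (hw : IsUnit w) (hD : D' = u • D) (hE : E' = v • E) (hF : F' = w • F)
    (h : LinImp D E F) : LinImp D' E' F' := by
  subst hD hE hF
  intro x hx
  rw [Matrix.smul_mulVec] at hx
  obtain ⟨y, hy⟩ := h x (hu.smul_left_cancel.mp (hx.trans (smul_zero u).symm))
  obtain ⟨w', hw'⟩ := hw.exists_right_inv
  refine ⟨(v * w') • y, ?_⟩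
  rw [Matrix.smul_mulVec, Matrix.smul_mulVec, Matrix.mulVec_smul, hy, smul_smul,
    mul_left_comm, hw', mul_one]

/-- If a linear implication between integral matrices holds in a ring `S` of fractions, then it
holds in every fraction ring of a generic fibre. -/
theorem exists_generic_linImp {A : Type*} [CommRing A] [IsDomain A] [IsNoetherianRing A] {n : ℕ}
    {S : Type*} [CommRing S] {φ : MvPolynomial (Fin n) A →+* S} (hφ : HasFracs φ)
    (hinj : Function.Injective φ) {d a e c : Type*} [Fintype d] [Fintype a] [Finite e] [Fintype c]
    (D : Matrix d a (MvPolynomial (Fin n) A)) (E : Matrix e a (MvPolynomial (Fin n) A))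
    (F : Matrix e c (MvPolynomial (Fin n) A)) (h : LinImp (D.map φ) (E.map φ) (F.map φ)) :
    ∃ (f : A) (g : MvPolynomial (Fin n) A), f ≠ 0 ∧ IsUnit (φ g) ∧
      ∀ (q : Ideal A), q.IsPrime → f ∉ q → ∀ (T : Type) [CommRing T]
        (ψ : MvPolynomial (Fin n) A →+* T), HasFracs ψ → (∀ x, ψ x = 0 ↔ x ∈ q.map C) →
        (∀ s ∉ q, IsUnit (ψ (C s))) → IsUnit (ψ g) →
        LinImp (D.map ψ) (E.map ψ) (F.map ψ) := by
  classical
  obtain ⟨f, hf0, hf⟩ := exists_generic_pure_submodule Finset.univ (LinearMap.range D.mulVecLin)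
  let Z := LinearMap.ker D.mulVecLin
  have hZ : ∀ z ∈ Z, ∃ g, IsUnit (φ g) ∧ g • E.mulVec z ∈ LinearMap.range F.mulVecLin := by
    intro z hz
    obtain ⟨y, hy⟩ := h (φ ∘ z) (by
      have hz' : D.mulVec z = 0 := hz
      ext i
      have := RingHom.map_mulVec φ D z i
      rw [hz'] at this
      simpa using this.symm)
    obtain ⟨w, g, hu, hw⟩ := hφ.exists_common y
    refine ⟨g, hu, w, ?_⟩
    ext1 i
    apply hinj
    rw [Matrix.mulVecLin_apply, RingHom.map_mulVec]
    have hw' : φ ∘ w = φ g • y := funext fun j => (hw j).symm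
    rw [hw', Matrix.mulVec_smul, hy, Pi.smul_apply, Pi.smul_apply, smul_eq_mul, smul_eq_mul,
      map_mul, RingHom.map_mulVec]
  obtain ⟨t, ht⟩ : Z.FG := IsNoetherian.noetherian Z
  have hg : ∃ g, IsUnit (φ g) ∧ ∀ z ∈ Z, g • E.mulVec z ∈ LinearMap.range F.mulVecLin := by
    choose! g hu hr using hZ
    refine ⟨∏ z ∈ t, g z, ?_, fun z hz => ?_⟩
    · rw [map_prod]
      refine (IsUnit.prod_iff).mpr fun z hz => hu z (ht ▸ Submodule.subset_span hz)
    · have hle : Z ≤ (LinearMap.range F.mulVecLin).comap ((∏ z ∈ t, g z) • E.mulVecLin) := by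
        rw [← ht, Submodule.span_le]
        intro z hz
        obtain ⟨r, hr'⟩ := Finset.dvd_prod_of_mem g hz
        change (∏ z ∈ t, g z) • E.mulVec z ∈ LinearMap.range F.mulVecLin
        rw [hr', mul_comm, mul_smul]
        exact Submodule.smul_mem _ _ (hr z (ht ▸ Submodule.subset_span hz))
      exact hle hz
  obtain ⟨g, hu, hg⟩ := hg
  refine ⟨f, g, hf0, hu, fun q hq hfq T _ ψ hψ hker hunit hgu x hx => ?_⟩
  obtain ⟨y, b, hb, hy⟩ := hψ.exists_common x
  have hy' : ψ ∘ y = ψ b • x := funext fun j => (hy j).symm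
  have hDy : ∀ i, D.mulVec y i ∈ q.map C := by
    intro i
    rw [← hker, RingHom.map_mulVec, hy', Matrix.mulVec_smul, hx, smul_zero, Pi.zero_apply]
  obtain ⟨s, hs, hsD⟩ := hf q hq hfq (D.mulVec y) ⟨y, rfl⟩ hDy (by simp)
  rw [LinearMap.range_eq_map, ← Submodule.map_smul''] at hsD
  obtain ⟨v, hv, hvD⟩ := hsD
  have hvq : ψ ∘ v = 0 := funext fun i => (hker _).mpr (apply_mem_of_mem_smul hv i)
  obtain ⟨w, hw⟩ := hg ((C s : MvPolynomial (Fin n) A) • y - v) (by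
    change D.mulVecLin _ = 0
    rw [map_sub, map_smul, hvD, Matrix.mulVecLin_apply, sub_self])
  have hz : ψ ∘ ((C s : MvPolynomial (Fin n) A) • y - v) = (ψ (C s) * ψ b) • x := by
    funext i
    have h1 := congrFun hvq i
    have h2 := congrFun hy' i
    simp only [Function.comp_apply, Pi.zero_apply, Pi.smul_apply, smul_eq_mul] at h1 h2
    simp [h1, h2, mul_assoc]
  have hfin : (F.map ψ).mulVec (ψ ∘ w) = (ψ g * (ψ (C s) * ψ b)) • (E.map ψ).mulVec x := by
    rw [mul_smul, ← Matrix.mulVec_smul, ← hz]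
    funext i
    rw [Pi.smul_apply, ← RingHom.map_mulVec, ← RingHom.map_mulVec, smul_eq_mul, ← map_mul]
    exact congrArg ψ (congrFun hw i)
  obtain ⟨r, hr⟩ := (hgu.mul ((hunit s hs).mul hb)).exists_left_inv
  exact ⟨r • (ψ ∘ w), by rw [Matrix.mulVec_smul, hfin, smul_smul, hr, one_smul]⟩

/-- A non-zero-divisor modulo a prime ideal stays one modulo the generic specializations. -/
theorem exists_generic_cancel {A : Type*} [CommRing A] [IsDomain A] {n : ℕ}
    (P : Ideal (MvPolynomial (Fin n) A)) [P.IsPrime] {g : MvPolynomial (Fin n) A} (hg : g ∉ P) :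
    ∃ f : A, f ≠ 0 ∧ ∀ q : Ideal A, q.IsPrime → f ∉ q → ∀ x, g * x ∈ P ⊔ q.map C →
      ∃ s, s ∉ q ∧ C s * x ∈ P ⊔ q.map C := by
  obtain ⟨f, hf0, hf⟩ := exists_generic_pure_ideal (P ⊔ Ideal.span {g})
  refine ⟨f, hf0, fun q hq hfq x hx => ?_⟩
  obtain ⟨p, hp, z, hz, hpz⟩ := Submodule.mem_sup.mp hx
  have hzJ : z ∈ P ⊔ Ideal.span {g} := by
    rw [show z = g * x - p by rw [← hpz]; ring]
    exact Ideal.sub_mem _ (Ideal.mul_mem_right _ _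
      (Ideal.mem_sup_right (Ideal.mem_span_singleton_self g))) (Ideal.mem_sup_left hp)
  obtain ⟨s, hs, hsz⟩ := hf q hq hfq z hzJ hz
  rw [Ideal.mul_sup] at hsz
  obtain ⟨p', hp', w, hw, hpw⟩ := Submodule.mem_sup.mp hsz
  obtain ⟨v, hv, hvw⟩ := Ideal.mem_mul_span_singleton.mp hw
  have hmem : g * (C s * x - v) ∈ P := by
    have : g * (C s * x - v) = C s * p + p' := by
      have : g * (C s * x - v) = C s * (g * x) - v * g := by ring
      rw [this, ← hpz, hvw, mul_add, ← hpw]; ring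
    rw [this]
    exact P.add_mem (P.mul_mem_left _ hp) ((Ideal.mul_le_right : q.map C * P ≤ P) hp')
  refine ⟨s, hs, ?_⟩
  rw [show C s * x = (C s * x - v) + v by ring]
  exact Ideal.add_mem _ (Ideal.mem_sup_left ((Ideal.IsPrime.mem_or_mem ‹_› hmem).resolve_left hg))
    (Ideal.mem_sup_right hv)

theorem HasFracs.exists_smul_eq_map {A F : Type*} [CommRing A] [Field F] {ρ : A →+* F}
    (hρ : HasFracs ρ) {σ : Type*} (f : MvPolynomial σ F) :
    ∃ (b : A) (p : MvPolynomial σ A), ρ b ≠ 0 ∧ C (ρ b) * f = MvPolynomial.map ρ p := by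
  obtain ⟨y, b, hb, hy⟩ := hρ.exists_common (fun i : f.support => f.coeff i)
  refine ⟨b, ∑ i : f.support, monomial (i : σ →₀ ℕ) (y i), hb.ne_zero, ?_⟩
  rw [map_sum]
  simp only [map_monomial, ← hy]
  conv_lhs => rw [f.as_sum, Finset.mul_sum, ← Finset.sum_coe_sort]
  exact Finset.sum_congr rfl fun i _ => by rw [C_mul_monomial]

theorem HasFracs.comp_map {A F : Type*} [CommRing A] [Field F] {ρ : A →+* F}
    (hρ : HasFracs ρ) {σ : Type*} (P : Ideal (MvPolynomial σ F)) [P.IsPrime]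
    (S : Type*) [CommRing S] [Algebra (MvPolynomial σ F) S] [IsLocalization.AtPrime S P] :
    HasFracs ((algebraMap (MvPolynomial σ F) S).comp (MvPolynomial.map ρ)) := by
  intro x
  obtain ⟨⟨f, g⟩, hx⟩ := IsLocalization.surj P.primeCompl x
  obtain ⟨b, p, hb, hp⟩ := hρ.exists_smul_eq_map f
  obtain ⟨b', h, hb', hh⟩ := hρ.exists_smul_eq_map (g : MvPolynomial σ F)
  have hunit : ∀ c : F, c ≠ 0 → IsUnit (algebraMap (MvPolynomial σ F) S (C c)) := fun c hc =>
    ((IsUnit.mk0 c hc).map C).map _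
  refine ⟨C b' * p, C b * h, ?_, ?_⟩
  · rw [RingHom.comp_apply, map_mul, map_C, map_mul, ← hh, map_mul]
    exact (hunit _ hb).mul ((hunit _ hb').mul (IsLocalization.map_units S g))
  · rw [RingHom.comp_apply, map_mul, map_C, map_mul, ← hh, map_mul, RingHom.comp_apply, map_mul,
      map_C, map_mul, ← hp, map_mul, ← hx]
    ring

theorem algebraMap_atPrime_injective {F : Type*} [Field F] {σ : Type*}
    (P : Ideal (MvPolynomial σ F)) [P.IsPrime]
    (S : Type*) [CommRing S] [Algebra (MvPolynomial σ F) S] [IsLocalization.AtPrime S P] :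
    Function.Injective (algebraMap (MvPolynomial σ F) S) :=
  IsLocalization.injective S P.primeCompl_le_nonZeroDivisors

theorem AlmostAll.and {K : Type} [Field K] {m : ℕ} {Q Q' : (Fin m → K) → Prop}
    (h : AlmostAll K m Q) (h' : AlmostAll K m Q') : AlmostAll K m fun α => Q α ∧ Q' α := by
  obtain ⟨c, hc, hQ⟩ := h
  obtain ⟨c', hc', hQ'⟩ := h'
  refine ⟨c * c', mul_ne_zero hc hc', fun α hα => ?_⟩
  rw [map_mul] at hα
  exact ⟨hQ α (left_ne_zero_of_mul hα), hQ' α (right_ne_zero_of_mul hα)⟩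

theorem AlmostAll.mono {K : Type} [Field K] {m : ℕ} {Q Q' : (Fin m → K) → Prop}
    (h : AlmostAll K m Q) (h' : ∀ α, Q α → Q' α) : AlmostAll K m Q' := by
  obtain ⟨c, hc, hQ⟩ := h
  exact ⟨c, hc, fun α hα => h' α (hQ α hα)⟩

section Specialization

variable (k K : Type) [Field k] [Field K] [Algebra k K]

theorem coe_evalα {m : ℕ} (α : Fin m → K) (f : MvPolynomial (Fin m) k) :
    (evalα k K α f : K) = aeval α f := by
  have : (kA k K α).val.comp (aeval fun i =>
      (⟨α i, IntermediateField.subset_adjoin k (Set.range α) ⟨i, rfl⟩⟩ : kA k K α)) = aeval α :=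
    algHom_ext fun i => by simp
  exact DFunLike.congr_fun this f

theorem almostAll_notMem_ker {m : ℕ} {f : MvPolynomial (Fin m) k} (hf : f ≠ 0) :
    AlmostAll K m fun α => f ∉ RingHom.ker (evalα k K α) := by
  refine ⟨MvPolynomial.map (algebraMap k K) f, ?_, fun α hα h => hα ?_⟩
  · rwa [Ne, map_eq_zero_iff _ (map_injective _ (algebraMap k K).injective)]
  · rw [eval_map, ← aeval_def, ← coe_evalα, RingHom.mem_ker.mp h]
    rfl

theorem hasFracs_evalα {m : ℕ} (α : Fin m → K) : HasFracs (evalα k K α) := by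
  rintro ⟨x, hx⟩
  obtain ⟨r, s, rfl⟩ := (IntermediateField.mem_adjoin_range_iff k α x).mp hx
  by_cases hs : aeval α s = 0
  · refine ⟨0, 1, by simp, ?_⟩
    ext
    simp [hs]
  · have hs' : evalα k K α s ≠ 0 := fun h => hs (by rw [← coe_evalα, h]; rfl)
    refine ⟨r, s, IsUnit.mk0 _ hs', ?_⟩
    ext
    simp only [IntermediateField.coe_mul, coe_evalα]
    exact mul_div_cancel₀ _ hs

theorem hasFracs_algebraMap (m : ℕ) :
    HasFracs (algebraMap (MvPolynomial (Fin m) k) (kU k m)) := by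
  intro x
  obtain ⟨⟨f, g⟩, hx⟩ := IsLocalization.surj (nonZeroDivisors (MvPolynomial (Fin m) k)) x
  exact ⟨f, g, IsLocalization.map_units _ g, by rw [mul_comm]; exact hx⟩

theorem toR_injective (m n : ℕ) : Function.Injective (toR k m n) :=
  map_injective _ (IsFractionRing.injective _ _)

theorem ker_toRa {m : ℕ} (n : ℕ) (α : Fin m → K) :
    RingHom.ker (toRa k K n α) = (RingHom.ker (evalα k K α)).map C :=
  ker_map _

theorem toRa_C {m : ℕ} (n : ℕ) (α : Fin m → K) (s : MvPolynomial (Fin m) k) :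
    toRa k K n α (C s) = C (evalα k K α s) :=
  map_C _ _

theorem isUnit_toRa_C {m : ℕ} (n : ℕ) {α : Fin m → K} {s : MvPolynomial (Fin m) k}
    (hs : s ∉ RingHom.ker (evalα k K α)) : IsUnit (toRa k K n α (C s)) := by
  rw [toRa_C]
  exact (IsUnit.mk0 _ hs).map C

theorem toRa_mem_idealSpec_iff {m : ℕ} (n : ℕ) (α : Fin m → K) (P : Ideal (Rg k m n))
    (x : MvPolynomial (Fin n) (MvPolynomial (Fin m) k)) :
    toRa k K n α x ∈ idealSpec k K n α P ↔ ∃ s, s ∉ RingHom.ker (evalα k K α) ∧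
      C s * x ∈ P.comap (toR k m n) ⊔ (RingHom.ker (evalα k K α)).map C := by
  constructor
  · have key : ∀ z ∈ idealSpec k K n α P, ∃ s, s ∉ RingHom.ker (evalα k K α) ∧
        ∃ p ∈ P.comap (toR k m n), toRa k K n α (C s) * z = toRa k K n α p := by
      intro z hz
      induction hz using Submodule.span_induction with
      | mem z hz =>
        obtain ⟨p, hp, rfl⟩ := hz
        exact ⟨1, by simp [RingHom.mem_ker], p, hp, by simp⟩
      | zero => exact ⟨1, by simp [RingHom.mem_ker], 0, zero_mem _, by simp⟩
      | add y z _ _ hy hz =>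
        obtain ⟨s, hs, p, hp, h⟩ := hy
        obtain ⟨t, ht, p', hp', h'⟩ := hz
        refine ⟨s * t, fun hst => ((RingHom.ker_isPrime _).mem_or_mem hst).elim hs ht,
          C t * p + C s * p', Ideal.add_mem _ (Ideal.mul_mem_left _ _ hp)
            (Ideal.mul_mem_left _ _ hp'), ?_⟩
        rw [map_add, map_mul _ (C t) p, map_mul _ (C s) p', ← h, ← h', C_mul, map_mul]
        ring
      | smul r z _ hz =>
        obtain ⟨s, hs, p, hp, h⟩ := hz
        obtain ⟨b, r', hb, hr⟩ := (hasFracs_evalα k K α).exists_smul_eq_map r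
        refine ⟨s * b, fun hst => ((RingHom.ker_isPrime _).mem_or_mem hst).elim hs hb,
          r' * p, Ideal.mul_mem_left _ _ hp, ?_⟩
        rw [C_mul, map_mul, map_mul, ← h, toRa_C, toRa_C, toRa, ← hr, smul_eq_mul]
        ring
    intro hx
    obtain ⟨s, hs, p, hp, h⟩ := key _ hx
    refine ⟨s, hs, ?_⟩
    rw [show C s * x = p + (C s * x - p) by ring]
    refine Ideal.add_mem _ (Ideal.mem_sup_left hp) (Ideal.mem_sup_right ?_)
    rw [← ker_toRa, RingHom.mem_ker, map_sub, map_mul, h, sub_self]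
  · rintro ⟨s, hs, h⟩
    obtain ⟨p, hp, z, hz, hpz⟩ := Submodule.mem_sup.mp h
    rw [← ker_toRa] at hz
    refine (Ideal.unit_mul_mem_iff_mem _ (isUnit_toRa_C k K n hs)).mp ?_
    rw [← map_mul, ← hpz, map_add, RingHom.mem_ker.mp hz, add_zero]
    exact Ideal.subset_span ⟨p, hp, rfl⟩

theorem almostAll_toRa_notMem {m n : ℕ} (P : Ideal (Rg k m n)) [P.IsPrime]
    {g : MvPolynomial (Fin n) (MvPolynomial (Fin m) k)} (hg : toR k m n g ∉ P) :
    AlmostAll K m fun α => ∀ ℘ : Ideal (Ra k K n α),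
      IsAssociatedPrime ℘ (Ra k K n α ⧸ idealSpec k K n α P) → toRa k K n α g ∉ ℘ := by
  obtain ⟨f, hf0, hf⟩ := exists_generic_cancel (P.comap (toR k m n)) (g := g) hg
  refine (almostAll_notMem_ker k K hf0).mono fun α hα ℘ h℘ hmem => ?_
  obtain ⟨hprime, x, hx⟩ := isAssociatedPrime_iff.mp h℘
  obtain ⟨x, rfl⟩ := Ideal.Quotient.mk_surjective x
  have hiff : ∀ r, r ∈ ℘ ↔ r * x ∈ idealSpec k K n α P := by
    intro r
    rw [hx, Submodule.mem_colon_singleton, Submodule.mem_bot]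
    exact Ideal.Quotient.eq_zero_iff_mem (I := idealSpec k K n α P) (a := r * x)
  refine hprime.ne_top (℘.eq_top_iff_one.mpr ((hiff 1).mpr ?_))
  rw [one_mul]
  obtain ⟨b, x', hb, hx'⟩ := (hasFracs_evalα k K α).exists_smul_eq_map x
  have hbu : IsUnit (C (evalα k K α b) : Ra k K n α) := (IsUnit.mk0 _ hb).map C
  have hgx : toRa k K n α (g * x') ∈ idealSpec k K n α P := by
    rw [map_mul, show toRa k K n α x' = C (evalα k K α b) * x from hx'.symm, mul_left_comm]
    exact Ideal.mul_mem_left _ _ ((hiff _).mp hmem)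
  obtain ⟨s, hs, hsx⟩ := (toRa_mem_idealSpec_iff k K n α P _).mp hgx
  rw [mul_left_comm] at hsx
  obtain ⟨t, ht, htx⟩ := hf _ (RingHom.ker_isPrime _) hα _ hsx
  refine (Ideal.unit_mul_mem_iff_mem _ hbu).mp ?_
  rw [hx']
  refine (toRa_mem_idealSpec_iff k K n α P _).mpr
    ⟨t * s, fun hst => ((RingHom.ker_isPrime _).mem_or_mem hst).elim ht hs, ?_⟩
  rwa [C_mul, mul_assoc]

variable {k K} {m n : ℕ}

/-- The canonical map from `k[u][X]` to `S`. -/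
abbrev toLoc (k : Type) [Field k] (m n : ℕ) (S : Type) [CommRing S] [Algebra (Rg k m n) S] :
    MvPolynomial (Fin n) (MvPolynomial (Fin m) k) →+* S :=
  (algebraMap (Rg k m n) S).comp (toR k m n)

/-- The canonical map from `k[u][X]` to `S_α`. -/
abbrev toLocSpec (α : Fin m → K) (Sα : Type) [CommRing Sα] [Algebra (Ra k K n α) Sα] :
    MvPolynomial (Fin n) (MvPolynomial (Fin m) k) →+* Sα :=
  (algebraMap (Ra k K n α) Sα).comp (toRa k K n α)

theorem hasFracs_toLoc (P : Ideal (Rg k m n)) [P.IsPrime] (S : Type) [CommRing S]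
    [Algebra (Rg k m n) S] [IsLocalization.AtPrime S P] : HasFracs (toLoc k m n S) :=
  (hasFracs_algebraMap k m).comp_map P S

theorem toLoc_injective (P : Ideal (Rg k m n)) [P.IsPrime] (S : Type) [CommRing S]
    [Algebra (Rg k m n) S] [IsLocalization.AtPrime S P] : Function.Injective (toLoc k m n S) :=
  (algebraMap_atPrime_injective P S).comp (toR_injective k m n)

variable (P : Ideal (Rg k m n)) [P.IsPrime]
  {S : Type} [CommRing S] [Algebra (Rg k m n) S] [IsLocalization.AtPrime S P]

theorem almostAll_isUnit_toLocSpec {g : MvPolynomial (Fin n) (MvPolynomial (Fin m) k)}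
    (hg : IsUnit (toLoc k m n S g)) :
    AlmostAll K m fun α => ∀ (℘ : Ideal (Ra k K n α))
      (h℘ : IsAssociatedPrime ℘ (Ra k K n α ⧸ idealSpec k K n α P)),
      haveI := h℘.isPrime
      ∀ (Sα : Type) [CommRing Sα] [Algebra (Ra k K n α) Sα] [IsLocalization.AtPrime Sα ℘],
        IsUnit (toLocSpec α Sα g) := by
  have hg' : toR k m n g ∉ P := (IsLocalization.AtPrime.isUnit_to_map_iff S P _).mp hg
  refine (almostAll_toRa_notMem k K P hg').mono fun α hα ℘ h℘ Sα _ _ _ => ?_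
  have := h℘.isPrime
  exact (IsLocalization.AtPrime.isUnit_to_map_iff Sα ℘ _).mpr (hα ℘ h℘)

section LocElemSpec

variable {P} {α : Fin m → K} {℘ : Ideal (Ra k K n α)} [℘.IsPrime]
  {Sα : Type} [CommRing Sα] [Algebra (Ra k K n α) Sα] [IsLocalization.AtPrime Sα ℘]

theorem ElemSpec.of_toR (p : MvPolynomial (Fin n) (MvPolynomial (Fin m) k)) :
    ElemSpec k K n α (toR k m n p) (toRa k K n α p) :=
  ⟨p, 1, by simp, by simp, by simp⟩

theorem ElemSpec.mul_eq {f h : Rg k m n} {fα hα : Ra k K n α} (hf : ElemSpec k K n α f fα)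
    (hh : ElemSpec k K n α h hα) {g p : MvPolynomial (Fin n) (MvPolynomial (Fin m) k)}
    (heq : toR k m n g * f = toR k m n p * h) :
    toRa k K n α g * fα = toRa k K n α p * hα := by
  obtain ⟨a, q, hq, ha, haα⟩ := hf
  obtain ⟨b, r, hr, hb, hbα⟩ := hh
  have h1 : C r * g * a = C q * p * b := by
    apply toR_injective k m n
    have hC : ∀ s, toR k m n (C s) = C (algebraMap _ (kU k m) s) := fun s => map_C _ _
    simp only [map_mul, hC, ← ha, ← hb]
    linear_combination (C (algebraMap _ (kU k m) r) * C (algebraMap _ (kU k m) q)) * heq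
  have h2 := congrArg (toRa k K n α) h1
  simp only [map_mul, toRa_C, ← haα, ← hbα] at h2
  have hne : ∀ c : kA k K α, c ≠ 0 → (C c : Ra k K n α) ≠ 0 := fun c hc => by
    rwa [Ne, C_eq_zero]
  refine mul_left_cancel₀ (mul_ne_zero (hne _ hr) (hne _ hq)) ?_
  linear_combination h2

theorem LocElemSpec.mul_eq {a : S} {aα : Sα} (h : LocElemSpec P ℘ a aα)
    {g p : MvPolynomial (Fin n) (MvPolynomial (Fin m) k)}
    (heq : toLoc k m n S g * a = toLoc k m n S p) :
    toLocSpec α Sα g * aα = toLocSpec α Sα p := by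
  obtain ⟨f, h, fα, hα, hh, hhα, hf, hh', rfl, rfl⟩ := h
  have h1 : toR k m n g * f = toR k m n p * h := by
    apply algebraMap_atPrime_injective P S
    rw [map_mul, map_mul]
    have := congrArg (· * algebraMap _ S h) heq
    simp only [mul_assoc] at this
    rwa [IsLocalization.mk'_spec' S f ⟨h, hh⟩ |> fun e => (mul_comm _ _).trans e] at this
  have h2 := congrArg (algebraMap _ Sα) (hf.mul_eq hh' h1)
  rw [map_mul, map_mul] at h2
  refine (IsLocalization.map_units Sα (⟨hα, hhα⟩ : ℘.primeCompl)).mul_right_cancel ?_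
  rw [mul_assoc, IsLocalization.mk'_spec]
  exact h2

theorem LocElemSpec.of_toLoc (p : MvPolynomial (Fin n) (MvPolynomial (Fin m) k)) :
    LocElemSpec P ℘ (toLoc k m n S p) (toLocSpec α Sα p) := by
  have h1 := ElemSpec.of_toR (α := α) (n := n) p
  have h2 := ElemSpec.of_toR (α := α) (n := n) (1 : MvPolynomial (Fin n) (MvPolynomial (Fin m) k))
  rw [map_one, map_one] at h2
  exact ⟨_, _, _, _, one_mem P.primeCompl, one_mem ℘.primeCompl, h1, h2,
    (IsLocalization.mk'_one S _).symm, (IsLocalization.mk'_one Sα _).symm⟩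

theorem LocElemSpec.zero : LocElemSpec P ℘ (0 : S) (0 : Sα) := by
  simpa using LocElemSpec.of_toLoc (P := P) (℘ := ℘) (S := S) (Sα := Sα) 0

theorem LocElemSpec.one : LocElemSpec P ℘ (1 : S) (1 : Sα) := by
  simpa using LocElemSpec.of_toLoc (P := P) (℘ := ℘) (S := S) (Sα := Sα) 1

theorem LocElemSpec.map_eq_smul {ι κ : Type} {M : Matrix ι κ S} {B : Matrix ι κ Sα}
    (h : ∀ i j, LocElemSpec P ℘ (M i j) (B i j)) {g}
    {M' : Matrix ι κ (MvPolynomial (Fin n) (MvPolynomial (Fin m) k))}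
    (hM : ∀ i j, toLoc k m n S g * M i j = toLoc k m n S (M' i j)) :
    M'.map (toLocSpec α Sα) = toLocSpec α Sα g • B := by
  ext i j
  exact ((h i j).mul_eq (hM i j)).symm

end LocElemSpec

/-- Linear implications between matrices are preserved by almost all specializations. -/
theorem LinImp.almostAll {d a e c : Type} [Fintype d] [Fintype a] [Finite e] [Fintype c]
    {D : Matrix d a S} {E : Matrix e a S} {F : Matrix e c S} (h : LinImp D E F) :
    AlmostAll K m fun α => ∀ (℘ : Ideal (Ra k K n α))
      (h℘ : IsAssociatedPrime ℘ (Ra k K n α ⧸ idealSpec k K n α P)),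
      haveI := h℘.isPrime
      ∀ (Sα : Type) [CommRing Sα] [Algebra (Ra k K n α) Sα] [IsLocalization.AtPrime Sα ℘]
        (D' : Matrix d a Sα) (E' : Matrix e a Sα) (F' : Matrix e c Sα),
        (∀ i j, LocElemSpec P ℘ (D i j) (D' i j)) → (∀ i j, LocElemSpec P ℘ (E i j) (E' i j)) →
        (∀ i j, LocElemSpec P ℘ (F i j) (F' i j)) → LinImp D' E' F' := by
  have hS : HasFracs (toLoc k m n S) := hasFracs_toLoc P S
  obtain ⟨D₀, u, hu, hD⟩ := hS.exists_common_matrix D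
  obtain ⟨E₀, v, hv, hE⟩ := hS.exists_common_matrix E
  obtain ⟨F₀, w, hw, hF⟩ := hS.exists_common_matrix F
  have h₀ : LinImp (D₀.map (toLoc k m n S)) (E₀.map (toLoc k m n S)) (F₀.map (toLoc k m n S)) :=
    h.smul (u := toLoc k m n S u) (v := toLoc k m n S v) (w := toLoc k m n S w) hu hw
      (by ext i j; exact (hD i j).symm) (by ext i j; exact (hE i j).symm)
      (by ext i j; exact (hF i j).symm)
  obtain ⟨f, g, hf, hg, hgen⟩ := exists_generic_linImp hS (toLoc_injective P S) D₀ E₀ F₀ h₀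
  refine (((almostAll_notMem_ker k K hf).and (almostAll_isUnit_toLocSpec P hg)).and
    ((almostAll_isUnit_toLocSpec P hv).and (almostAll_isUnit_toLocSpec P hw))).mono ?_
  rintro α ⟨⟨h1, h2⟩, h3, h4⟩ ℘ h℘ Sα _ _ _ D' E' F' hD' hE' hF'
  have := h℘.isPrime
  refine LinImp.of_smul (h3 ℘ h℘ Sα) (LocElemSpec.map_eq_smul hD' hD)
    (LocElemSpec.map_eq_smul hE' hE) (LocElemSpec.map_eq_smul hF' hF) ?_
  refine hgen _ (RingHom.ker_isPrime _) h1 Sα _ ((hasFracs_evalα k K α).comp_map ℘ Sα) ?_ ?_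
    (h2 ℘ h℘ Sα)
  · intro x
    rw [← ker_toRa, RingHom.mem_ker, RingHom.comp_apply,
      map_eq_zero_iff _ (algebraMap_atPrime_injective ℘ Sα)]
  · exact fun s hs => (isUnit_toRa_C k K n hs).map (algebraMap (Ra k K n α) Sα)

/-- Mapping the entries of a scalar multiple of a matrix. -/
theorem matrix_map_smul {R T : Type*} [CommRing R] [CommRing T] (ρ : R →+* T) {ι κ : Type*}
    (r : R) (A : Matrix ι κ R) : (r • A).map ρ = ρ r • A.map ρ := by
  ext i j
  simp

/-- Equalities between products of matrices are preserved by almost all specializations. -/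
theorem almostAll_mul_eq_mul {a b c d : Type} [Finite a] [Fintype b] [Fintype c] [Finite d]
    {A : Matrix a b S} {B : Matrix b d S} {C : Matrix a c S} {D : Matrix c d S}
    (h : A * B = C * D) :
    AlmostAll K m fun α => ∀ (℘ : Ideal (Ra k K n α))
      (h℘ : IsAssociatedPrime ℘ (Ra k K n α ⧸ idealSpec k K n α P)),
      haveI := h℘.isPrime
      ∀ (Sα : Type) [CommRing Sα] [Algebra (Ra k K n α) Sα] [IsLocalization.AtPrime Sα ℘]
        (A' : Matrix a b Sα) (B' : Matrix b d Sα) (C' : Matrix a c Sα) (D' : Matrix c d Sα),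
        (∀ i j, LocElemSpec P ℘ (A i j) (A' i j)) → (∀ i j, LocElemSpec P ℘ (B i j) (B' i j)) →
        (∀ i j, LocElemSpec P ℘ (C i j) (C' i j)) → (∀ i j, LocElemSpec P ℘ (D i j) (D' i j)) →
        A' * B' = C' * D' := by
  have hS : HasFracs (toLoc k m n S) := hasFracs_toLoc P S
  obtain ⟨A₀, s, hs, hA⟩ := hS.exists_common_matrix A
  obtain ⟨B₀, t, ht, hB⟩ := hS.exists_common_matrix B
  obtain ⟨C₀, u, hu, hC⟩ := hS.exists_common_matrix C
  obtain ⟨D₀, v, hv, hD⟩ := hS.exists_common_matrix D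
  have h₀ : (u * v) • (A₀ * B₀) = (s * t) • (C₀ * D₀) := by
    apply Matrix.map_injective (toLoc_injective P S)
    change ((u * v) • (A₀ * B₀)).map (toLoc k m n S) = ((s * t) • (C₀ * D₀)).map (toLoc k m n S)
    have hA' : A₀.map (toLoc k m n S) = toLoc k m n S s • A := by ext i j; exact (hA i j).symm
    have hB' : B₀.map (toLoc k m n S) = toLoc k m n S t • B := by ext i j; exact (hB i j).symm
    have hC' : C₀.map (toLoc k m n S) = toLoc k m n S u • C := by ext i j; exact (hC i j).symm
    have hD' : D₀.map (toLoc k m n S) = toLoc k m n S v • D := by ext i j; exact (hD i j).symm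
    rw [matrix_map_smul, matrix_map_smul, Matrix.map_mul,
      Matrix.map_mul, hA', hB', hC', hD']
    simp only [Matrix.smul_mul, Matrix.mul_smul, smul_smul, h, map_mul]
    congr 1
    ring
  refine (((almostAll_isUnit_toLocSpec P hs).and (almostAll_isUnit_toLocSpec P ht)).and
    ((almostAll_isUnit_toLocSpec P hu).and (almostAll_isUnit_toLocSpec P hv))).mono ?_
  rintro α ⟨⟨h1, h2⟩, h3, h4⟩ ℘ h℘ Sα _ _ _ A' B' C' D' hA' hB' hC' hD'
  have := h℘.isPrime
  have h5 := congrArg (fun M => M.map (toLocSpec (k := k) (n := n) α Sα)) h₀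
  simp only [matrix_map_smul, Matrix.map_mul,
    LocElemSpec.map_eq_smul hA' hA, LocElemSpec.map_eq_smul hB' hB,
    LocElemSpec.map_eq_smul hC' hC, LocElemSpec.map_eq_smul hD' hD,
    Matrix.smul_mul, Matrix.mul_smul, smul_smul, map_mul] at h5
  refine (((h1 ℘ h℘ Sα).mul (h2 ℘ h℘ Sα)).mul
    ((h3 ℘ h℘ Sα).mul (h4 ℘ h℘ Sα))).smul_left_cancel.mp ?_
  convert h5 using 2 <;> ring

end Specialization

section Presentations

variable {T : Type} [CommRing T]

theorem linImp_fromCols {a b e c : Type*} [Fintype a] [Fintype b] [Fintype c] {d : Type*}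
    {D₁ : Matrix d a T} {D₂ : Matrix d b T} {E₁ : Matrix e a T} {E₂ : Matrix e b T}
    {F : Matrix e c T} :
    LinImp (Matrix.fromCols D₁ D₂) (Matrix.fromCols E₁ E₂) F ↔
      ∀ x y, D₁.mulVec x + D₂.mulVec y = 0 → ∃ z, F.mulVec z = E₁.mulVec x + E₂.mulVec y := by
  constructor
  · intro h x y hxy
    simpa [Matrix.fromCols_mulVec] using h (Sum.elim x y) (by simpa [Matrix.fromCols_mulVec])
  · intro h x hx
    rw [Matrix.fromCols_mulVec] at hx ⊢
    exact h _ _ hx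

theorem exists_fromCols_mulVec_iff {a b d : Type*} [Fintype a] [Fintype b]
    {D₁ : Matrix d a T} {D₂ : Matrix d b T} {v : d → T} :
    (∃ z, (Matrix.fromCols D₁ D₂).mulVec z = v) ↔
      ∃ x y, D₁.mulVec x + D₂.mulVec y = v := by
  constructor
  · rintro ⟨z, hz⟩
    exact ⟨_, _, (Matrix.fromCols_mulVec ..).symm.trans hz⟩
  · rintro ⟨x, y, h⟩
    exact ⟨Sum.elim x y, by simpa [Matrix.fromCols_mulVec]⟩

variable {L : Type} [AddCommGroup L] [Module T L] {rL sL : ℕ}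

theorem Present.π_eq_zero_iff (pL : Present T rL sL L) {x : Fin rL → T} :
    pL.π x = 0 ↔ ∃ y, pL.A.mulVec y = x := by
  rw [← LinearMap.mem_ker, pL.ker_eq]
  rfl

theorem Present.π_mulVec (pL : Present T rL sL L) (y : Fin sL → T) :
    pL.π (pL.A.mulVec y) = 0 :=
  pL.π_eq_zero_iff.mpr ⟨y, rfl⟩

theorem Present.π_eq_iff (pL : Present T rL sL L) {x x' : Fin rL → T} :
    pL.π x = pL.π x' ↔ ∃ y, x + pL.A.mulVec y = x' := by
  rw [eq_comm, ← sub_eq_zero, ← map_sub, pL.π_eq_zero_iff]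
  simp only [eq_sub_iff_add_eq']

variable {pL : Present T rL sL L} {M : Type} [AddCommGroup M] [Module T M] {rM sM : ℕ}
  {pM : Present T rM sM M} {v : M →ₗ[T] L}

theorem MapLift.π_mulVec (l : MapLift pM pL v) (x : Fin rM → T) :
    pL.π (l.V0.mulVec x) = v (pM.π x) :=
  LinearMap.congr_fun l.comm0 x

theorem MapLift.mem_range_iff (l : MapLift pM pL v) {x : Fin rL → T} :
    pL.π x ∈ LinearMap.range v ↔ ∃ y z, l.V0.mulVec y + pL.A.mulVec z = x := by
  simp only [← pL.π_eq_iff, l.π_mulVec]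
  rw [LinearMap.mem_range, pM.surj.exists]

theorem MapLift.linImp_of_injective (l : MapLift pM pL v) (hv : Function.Injective v) :
    LinImp (Matrix.fromCols l.V0 pL.A) (Matrix.fromCols 1 0) pM.A := by
  refine linImp_fromCols.mpr fun x y hxy => ?_
  have h := congrArg pL.π hxy
  rw [map_add, l.π_mulVec, pL.π_mulVec, add_zero, map_zero, map_eq_zero_iff v hv] at h
  simpa using pM.π_eq_zero_iff.mp h

theorem MapLift.linImp_of_surjective (l : MapLift pM pL v) (hv : Function.Surjective v) :
    LinImp (0 : Matrix (Fin 0) (Fin rL) T) 1 (Matrix.fromCols l.V0 pL.A) := by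
  intro x _
  rw [Matrix.one_mulVec, exists_fromCols_mulVec_iff, ← l.mem_range_iff]
  exact hv _

variable {N : Type} [AddCommGroup N] [Module T N] {rN sN : ℕ}
  {pN : Present T rN sN N} {w : N →ₗ[T] L}
  {I : Type} [AddCommGroup I] [Module T I] {rI sI : ℕ}
  {pI : Present T rI sI I} {o : I →ₗ[T] L}

theorem MapLift.linImp_of_range_le (l : MapLift pM pL v) (l' : MapLift pN pL w)
    (h : LinearMap.range v ≤ LinearMap.range w) :
    LinImp (0 : Matrix (Fin 0) (Fin rM) T) l.V0 (Matrix.fromCols l'.V0 pL.A) := by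
  intro x _
  rw [exists_fromCols_mulVec_iff, ← l'.mem_range_iff, l.π_mulVec]
  exact h ⟨_, rfl⟩

theorem MapLift.linImp_of_inf_le (l : MapLift pM pL v) (l' : MapLift pN pL w)
    (l'' : MapLift pI pL o)
    (h : LinearMap.range v ⊓ LinearMap.range w ≤ LinearMap.range o) :
    LinImp (Matrix.fromCols (Matrix.fromCols l.V0 l'.V0) pL.A)
      (Matrix.fromCols (Matrix.fromCols l.V0 0) 0) (Matrix.fromCols l''.V0 pL.A) := by
  refine linImp_fromCols.mpr fun x y hxy => ?_
  rw [Matrix.zero_mulVec, add_zero, exists_fromCols_mulVec_iff, ← l''.mem_range_iff]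
  rw [Matrix.fromCols_mulVec] at hxy ⊢
  rw [Matrix.zero_mulVec, add_zero]
  refine h ⟨l.π_mulVec _ ▸ ⟨_, rfl⟩, ?_⟩
  refine l'.mem_range_iff.mpr ⟨-(x ∘ Sum.inr), -y, ?_⟩
  rw [Matrix.mulVec_neg, Matrix.mulVec_neg, ← sub_eq_zero, ← neg_eq_zero, ← hxy]
  abel

theorem MapLift.linImp_of_le_sup (l : MapLift pM pL v) (l' : MapLift pN pL w)
    (l'' : MapLift pI pL o)
    (h : LinearMap.range o ≤ LinearMap.range v ⊔ LinearMap.range w) :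
    LinImp (0 : Matrix (Fin 0) (Fin rI) T) l''.V0
      (Matrix.fromCols (Matrix.fromCols l.V0 l'.V0) pL.A) := by
  intro x _
  have hx : pL.π (l''.V0.mulVec x) ∈ LinearMap.range v ⊔ LinearMap.range w :=
    h (l''.π_mulVec x ▸ ⟨_, rfl⟩)
  obtain ⟨_, ⟨a, rfl⟩, _, ⟨b, rfl⟩, hab⟩ := Submodule.mem_sup.mp hx
  obtain ⟨a, rfl⟩ := pM.surj a
  obtain ⟨b, rfl⟩ := pN.surj b
  rw [← l.π_mulVec, ← l'.π_mulVec, ← map_add, pL.π_eq_iff] at hab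
  obtain ⟨y, hy⟩ := hab
  exact exists_fromCols_mulVec_iff.mpr ⟨Sum.elim a b, y, by simpa [Matrix.fromCols_mulVec]⟩

variable {Q : Type} [AddCommGroup Q] [Module T Q] {rQ sQ : ℕ}
  {pQ : Present T rQ sQ Q} {q : L →ₗ[T] Q}

theorem MapLift.linImp_of_ker_le (l : MapLift pM pL v) (l' : MapLift pL pQ q)
    (h : LinearMap.ker q ≤ LinearMap.range v) :
    LinImp (Matrix.fromCols l'.V0 pQ.A) (Matrix.fromCols 1 0) (Matrix.fromCols l.V0 pL.A) := by
  refine linImp_fromCols.mpr fun x y hxy => ?_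
  have h1 := congrArg pQ.π hxy
  rw [map_add, l'.π_mulVec, pQ.π_mulVec, add_zero, map_zero] at h1
  rw [Matrix.one_mulVec, Matrix.zero_mulVec, add_zero, exists_fromCols_mulVec_iff,
    ← l.mem_range_iff]
  exact h h1

theorem MapLift.linImp_of_le_ker (l : MapLift pM pL v) (l' : MapLift pL pQ q)
    (h : LinearMap.range v ≤ LinearMap.ker q) :
    LinImp (Matrix.fromCols 1 l.V0) (Matrix.fromCols l'.V0 0) pQ.A := by
  refine linImp_fromCols.mpr fun x y hxy => ?_
  rw [Matrix.zero_mulVec, add_zero, ← pQ.π_eq_zero_iff, l'.π_mulVec]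
  refine h (l.mem_range_iff.mpr ⟨-y, 0, ?_⟩)
  rw [Matrix.one_mulVec] at hxy
  rw [Matrix.mulVec_zero, add_zero, Matrix.mulVec_neg, neg_eq_iff_add_eq_zero, add_comm, hxy]

end Presentations

section CokerMap

variable {T : Type} [CommRing T] {rL sL rM sM rN sN rI sI rQ sQ : ℕ}
  {BL : Matrix (Fin rL) (Fin sL) T} {BM : Matrix (Fin rM) (Fin sM) T}
  {BN : Matrix (Fin rN) (Fin sN) T} {BI : Matrix (Fin rI) (Fin sI) T}
  {BQ : Matrix (Fin rQ) (Fin sQ) T}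
  {V : Matrix (Fin rL) (Fin rM) T} {W : Matrix (Fin rL) (Fin rN) T}
  {U : Matrix (Fin rL) (Fin rI) T} {O : Matrix (Fin rQ) (Fin rL) T}
  {hV : LinearMap.range BM.mulVecLin ≤ (LinearMap.range BL.mulVecLin).comap V.mulVecLin}
  {hW : LinearMap.range BN.mulVecLin ≤ (LinearMap.range BL.mulVecLin).comap W.mulVecLin}
  {hU : LinearMap.range BI.mulVecLin ≤ (LinearMap.range BL.mulVecLin).comap U.mulVecLin}
  {hO : LinearMap.range BL.mulVecLin ≤ (LinearMap.range BQ.mulVecLin).comap O.mulVecLin}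

theorem matCoker_mk_eq_zero_iff {x : Fin rL → T} :
    (Submodule.Quotient.mk x : MatCoker BL) = 0 ↔ ∃ y, BL.mulVec y = x := by
  rw [Submodule.Quotient.mk_eq_zero]
  rfl

theorem matCoker_mk_eq_iff {x x' : Fin rL → T} :
    (Submodule.Quotient.mk x : MatCoker BL) = Submodule.Quotient.mk x' ↔
      ∃ y, x + BL.mulVec y = x' := by
  rw [eq_comm, ← sub_eq_zero, ← Submodule.Quotient.mk_sub, matCoker_mk_eq_zero_iff]
  simp only [eq_sub_iff_add_eq']

theorem cokerMap_mk (x : Fin rM → T) :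
    cokerMap V hV (Submodule.Quotient.mk x) = Submodule.Quotient.mk (V.mulVec x) := rfl

theorem mk_mem_range_cokerMap_iff {x : Fin rL → T} :
    (Submodule.Quotient.mk x : MatCoker BL) ∈ LinearMap.range (cokerMap V hV) ↔
      ∃ y z, V.mulVec y + BL.mulVec z = x := by
  rw [LinearMap.mem_range, (Submodule.Quotient.mk_surjective _).exists]
  simp only [cokerMap_mk, matCoker_mk_eq_iff]

theorem cokerMap_injective
    (h : LinImp (Matrix.fromCols V BL) (Matrix.fromCols 1 0) BM) :
    Function.Injective (cokerMap V hV) := by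
  rw [injective_iff_map_eq_zero]
  intro x
  obtain ⟨x, rfl⟩ := Submodule.Quotient.mk_surjective _ x
  rw [cokerMap_mk, matCoker_mk_eq_zero_iff, matCoker_mk_eq_zero_iff]
  rintro ⟨y, hy⟩
  simpa using linImp_fromCols.mp h x (-y) (by rw [Matrix.mulVec_neg, hy, add_neg_cancel])

theorem cokerMap_surjective
    (h : LinImp (0 : Matrix (Fin 0) (Fin rL) T) 1 (Matrix.fromCols V BL)) :
    Function.Surjective (cokerMap V hV) := by
  intro x
  obtain ⟨x, rfl⟩ := Submodule.Quotient.mk_surjective _ x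
  refine mk_mem_range_cokerMap_iff.mpr (exists_fromCols_mulVec_iff.mp ?_)
  simpa using h x (Subsingleton.elim _ _)

theorem range_cokerMap_le
    (h : LinImp (0 : Matrix (Fin 0) (Fin rM) T) V (Matrix.fromCols W BL)) :
    LinearMap.range (cokerMap V hV) ≤ LinearMap.range (cokerMap W hW) := by
  rintro _ ⟨x, rfl⟩
  obtain ⟨x, rfl⟩ := Submodule.Quotient.mk_surjective _ x
  exact mk_mem_range_cokerMap_iff.mpr
    (exists_fromCols_mulVec_iff.mp (h x (Subsingleton.elim _ _)))

theorem inf_range_cokerMap_le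
    (h : LinImp (Matrix.fromCols (Matrix.fromCols V W) BL)
      (Matrix.fromCols (Matrix.fromCols V 0) 0) (Matrix.fromCols U BL)) :
    LinearMap.range (cokerMap V hV) ⊓ LinearMap.range (cokerMap W hW) ≤
      LinearMap.range (cokerMap U hU) := by
  rintro _ ⟨⟨x, rfl⟩, hx⟩
  obtain ⟨x, rfl⟩ := Submodule.Quotient.mk_surjective _ x
  obtain ⟨y, z, hyz⟩ := mk_mem_range_cokerMap_iff.mp hx
  rw [Matrix.mulVecLin_apply] at hyz
  have := linImp_fromCols.mp h (Sum.elim x (-y)) (-z) (by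
    simp only [Matrix.fromCols_mulVec, Sum.elim_comp_inl, Sum.elim_comp_inr, Matrix.mulVec_neg]
    rw [← hyz]
    abel)
  refine mk_mem_range_cokerMap_iff.mpr (exists_fromCols_mulVec_iff.mp ?_)
  simpa [Matrix.fromCols_mulVec] using this

theorem range_cokerMap_le_sup
    (h : LinImp (0 : Matrix (Fin 0) (Fin rI) T) U (Matrix.fromCols (Matrix.fromCols V W) BL)) :
    LinearMap.range (cokerMap U hU) ≤
      LinearMap.range (cokerMap V hV) ⊔ LinearMap.range (cokerMap W hW) := by
  rintro _ ⟨x, rfl⟩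
  obtain ⟨x, rfl⟩ := Submodule.Quotient.mk_surjective _ x
  obtain ⟨y, z, hyz⟩ := exists_fromCols_mulVec_iff.mp (h x (Subsingleton.elim _ _))
  rw [Matrix.fromCols_mulVec] at hyz
  rw [cokerMap_mk, ← matCoker_mk_eq_iff.mpr ⟨z, hyz⟩, Submodule.Quotient.mk_add]
  exact Submodule.add_mem_sup ⟨Submodule.Quotient.mk _, rfl⟩ ⟨Submodule.Quotient.mk _, rfl⟩

theorem ker_cokerMap_le
    (h : LinImp (Matrix.fromCols O BQ) (Matrix.fromCols 1 0) (Matrix.fromCols V BL)) :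
    LinearMap.ker (cokerMap O hO) ≤ LinearMap.range (cokerMap V hV) := by
  intro x hx
  obtain ⟨x, rfl⟩ := Submodule.Quotient.mk_surjective _ x
  rw [LinearMap.mem_ker, cokerMap_mk, matCoker_mk_eq_zero_iff] at hx
  obtain ⟨y, hy⟩ := hx
  refine mk_mem_range_cokerMap_iff.mpr (exists_fromCols_mulVec_iff.mp ?_)
  simpa using linImp_fromCols.mp h x (-y) (by rw [Matrix.mulVec_neg, hy, add_neg_cancel])

theorem range_cokerMap_le_ker
    (h : LinImp (Matrix.fromCols 1 V) (Matrix.fromCols O 0) BQ) :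
    LinearMap.range (cokerMap V hV) ≤ LinearMap.ker (cokerMap O hO) := by
  rintro _ ⟨x, rfl⟩
  obtain ⟨x, rfl⟩ := Submodule.Quotient.mk_surjective _ x
  rw [LinearMap.mem_ker, cokerMap_mk, cokerMap_mk, matCoker_mk_eq_zero_iff]
  simpa using linImp_fromCols.mp h (V.mulVec x) (-x) (by
    rw [Matrix.one_mulVec, Matrix.mulVec_neg, add_neg_cancel])

end CokerMap

section MatrixSpecialization

variable {k K : Type} [Field k] [Field K] [Algebra k K] {m n : ℕ} {α : Fin m → K}
  {P : Ideal (Rg k m n)} [P.IsPrime] {℘ : Ideal (Ra k K n α)} [℘.IsPrime]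
  {S : Type} [CommRing S] [Algebra (Rg k m n) S] [IsLocalization.AtPrime S P]
  {Sα : Type} [CommRing Sα] [Algebra (Ra k K n α) Sα] [IsLocalization.AtPrime Sα ℘]

theorem LocElemSpec.matrix_zero {ι κ : Type*} (i : ι) (j : κ) :
    LocElemSpec P ℘ ((0 : Matrix ι κ S) i j) ((0 : Matrix ι κ Sα) i j) :=
  LocElemSpec.zero

theorem LocElemSpec.matrix_one {ι : Type*} [DecidableEq ι] (i j : ι) :
    LocElemSpec P ℘ ((1 : Matrix ι ι S) i j) ((1 : Matrix ι ι Sα) i j) := by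
  by_cases h : i = j
  · subst h
    simpa only [Matrix.one_apply_eq] using LocElemSpec.one
  · simpa only [Matrix.one_apply_ne h] using LocElemSpec.zero

theorem LocElemSpec.fromCols {ι κ κ' : Type*} {A : Matrix ι κ S} {B : Matrix ι κ' S}
    {A' : Matrix ι κ Sα} {B' : Matrix ι κ' Sα} (hA : ∀ i j, LocElemSpec P ℘ (A i j) (A' i j))
    (hB : ∀ i j, LocElemSpec P ℘ (B i j) (B' i j)) (i : ι) (j : κ ⊕ κ') :
    LocElemSpec P ℘ (Matrix.fromCols A B i j) (Matrix.fromCols A' B' i j) := by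
  cases j
  · exact hA _ _
  · exact hB _ _

end MatrixSpecialization

/-- for submodules `M, N` of a finitely generated `S`-module `L`,
specialization is compatible with quotients, intersections and sums: for almost
all `α`, identifying `M_α` and `N_α` with submodules of `L_α` via the (injective)
specializations of the inclusion maps, one has `(L/M)_α ≅ L_α/M_α`,
`(M ∩ N)_α ≅ M_α ∩ N_α` and `(M + N)_α ≅ M_α + N_α`. -/
theorem specialization_of_submodule_operations
    (k K : Type) [Field k] [Field K] [Algebra k K] [Infinite K] {m n : ℕ}
    (P : Ideal (Rg k m n)) [P.IsPrime]
    (S : Type) [CommRing S] [Algebra (Rg k m n) S] [IsLocalization.AtPrime S P]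
    (L : Type) [AddCommGroup L] [Module S L] [Module.Finite S L]
    (M N : Submodule S L)
    {rL sL rM sM rN sN rI sI rJ sJ rQ sQ : ℕ}
    (pL : Present S rL sL L) (pM : Present S rM sM M) (pN : Present S rN sN N)
    (pI : Present S rI sI (M ⊓ N : Submodule S L))
    (pJ : Present S rJ sJ (M ⊔ N : Submodule S L))
    (pQ : Present S rQ sQ (L ⧸ M))
    (lM : MapLift pM pL M.subtype) (lN : MapLift pN pL N.subtype)
    (lI : MapLift pI pL (M ⊓ N).subtype) (lJ : MapLift pJ pL (M ⊔ N).subtype)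
    (lQ : MapLift pL pQ M.mkQ) :
    AlmostAll K m fun α =>
      ∀ (℘ : Ideal (Ra k K n α))
        (h℘ : IsAssociatedPrime ℘ ((Ra k K n α) ⧸ idealSpec k K n α P)),
        haveI := h℘.isPrime
        ∀ (Sα : Type) [CommRing Sα] [Algebra (Ra k K n α) Sα]
          [IsLocalization.AtPrime Sα ℘]
          (BL : Matrix (Fin rL) (Fin sL) Sα) (BM : Matrix (Fin rM) (Fin sM) Sα)
          (BN : Matrix (Fin rN) (Fin sN) Sα) (BI : Matrix (Fin rI) (Fin sI) Sα)
          (BJ : Matrix (Fin rJ) (Fin sJ) Sα) (BQ : Matrix (Fin rQ) (Fin sQ) Sα)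
          (uM0 : Matrix (Fin rL) (Fin rM) Sα) (uM1 : Matrix (Fin sL) (Fin sM) Sα)
          (uN0 : Matrix (Fin rL) (Fin rN) Sα) (uN1 : Matrix (Fin sL) (Fin sN) Sα)
          (uI0 : Matrix (Fin rL) (Fin rI) Sα) (uI1 : Matrix (Fin sL) (Fin sI) Sα)
          (uJ0 : Matrix (Fin rL) (Fin rJ) Sα) (uJ1 : Matrix (Fin sL) (Fin sJ) Sα)
          (uQ0 : Matrix (Fin rQ) (Fin rL) Sα) (uQ1 : Matrix (Fin sQ) (Fin sL) Sα),
          MatSpec (LocElemSpec P ℘) pL.A BL → MatSpec (LocElemSpec P ℘) pM.A BM →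
          MatSpec (LocElemSpec P ℘) pN.A BN → MatSpec (LocElemSpec P ℘) pI.A BI →
          MatSpec (LocElemSpec P ℘) pJ.A BJ → MatSpec (LocElemSpec P ℘) pQ.A BQ →
          MatSpec (LocElemSpec P ℘) lM.V0 uM0 → MatSpec (LocElemSpec P ℘) lM.V1 uM1 →
          MatSpec (LocElemSpec P ℘) lN.V0 uN0 → MatSpec (LocElemSpec P ℘) lN.V1 uN1 →
          MatSpec (LocElemSpec P ℘) lI.V0 uI0 → MatSpec (LocElemSpec P ℘) lI.V1 uI1 →
          MatSpec (LocElemSpec P ℘) lJ.V0 uJ0 → MatSpec (LocElemSpec P ℘) lJ.V1 uJ1 →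
          MatSpec (LocElemSpec P ℘) lQ.V0 uQ0 → MatSpec (LocElemSpec P ℘) lQ.V1 uQ1 →
          ∃ (hM : uM0 * BM = BL * uM1) (hN : uN0 * BN = BL * uN1)
            (hI : uI0 * BI = BL * uI1) (hJ : uJ0 * BJ = BL * uJ1)
            (hQ : uQ0 * BL = BQ * uQ1),
            Function.Injective (cokerMap uM0 (comm_le hM)) ∧
            Function.Injective (cokerMap uN0 (comm_le hN)) ∧
            Function.Injective (cokerMap uI0 (comm_le hI)) ∧
            Function.Injective (cokerMap uJ0 (comm_le hJ)) ∧
            LinearMap.range (cokerMap uI0 (comm_le hI)) =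
              LinearMap.range (cokerMap uM0 (comm_le hM)) ⊓
                LinearMap.range (cokerMap uN0 (comm_le hN)) ∧
            LinearMap.range (cokerMap uJ0 (comm_le hJ)) =
              LinearMap.range (cokerMap uM0 (comm_le hM)) ⊔
                LinearMap.range (cokerMap uN0 (comm_le hN)) ∧
            Function.Surjective (cokerMap uQ0 (comm_le hQ)) ∧
            LinearMap.ker (cokerMap uQ0 (comm_le hQ)) =
              LinearMap.range (cokerMap uM0 (comm_le hM)) := by
  have iM := M.range_subtype
  have iN := N.range_subtype
  have iI := (M ⊓ N).range_subtype
  have iJ := (M ⊔ N).range_subtype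
  have key :=
    (((almostAll_mul_eq_mul (K := K) P lM.comm1).and
      (almostAll_mul_eq_mul (K := K) P lN.comm1)).and
      (((almostAll_mul_eq_mul (K := K) P lI.comm1).and
        (almostAll_mul_eq_mul (K := K) P lJ.comm1)).and
        (almostAll_mul_eq_mul (K := K) P lQ.comm1))).and
    (((((lM.linImp_of_injective M.subtype_injective).almostAll (K := K) P).and
      ((lN.linImp_of_injective N.subtype_injective).almostAll (K := K) P)).and
      (((lI.linImp_of_injective (M ⊓ N).subtype_injective).almostAll (K := K) P).and
      ((lJ.linImp_of_injective (M ⊔ N).subtype_injective).almostAll (K := K) P))).and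
    (((((lI.linImp_of_range_le lM (by rw [iI, iM]; exact inf_le_left)).almostAll (K := K) P).and
      ((lI.linImp_of_range_le lN (by rw [iI, iN]; exact inf_le_right)).almostAll (K := K) P)).and
      ((lM.linImp_of_inf_le lN lI (by rw [iM, iN, iI])).almostAll (K := K) P)).and
    (((((lM.linImp_of_range_le lJ (by rw [iM, iJ]; exact le_sup_left)).almostAll (K := K) P).and
      ((lN.linImp_of_range_le lJ (by rw [iN, iJ]; exact le_sup_right)).almostAll (K := K) P)).and
      ((lM.linImp_of_le_sup lN lJ (by rw [iM, iN, iJ])).almostAll (K := K) P)).and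
    (((lQ.linImp_of_surjective M.mkQ_surjective).almostAll (K := K) P).and
      (((lM.linImp_of_ker_le lQ (by rw [iM, M.ker_mkQ])).almostAll (K := K) P).and
      ((lM.linImp_of_le_ker lQ (by rw [iM, M.ker_mkQ])).almostAll (K := K) P))))))
  refine key.mono ?_
  rintro α ⟨⟨⟨cM, cN⟩, ⟨cI, cJ⟩, cQ⟩, ⟨⟨jM, jN⟩, jI, jJ⟩, ⟨⟨IM, IN⟩, MNI⟩, ⟨⟨MJ, NJ⟩, JMN⟩,
    qs, qM, Mq⟩ ℘ h℘ Sα _ _ _ BL BM BN BI BJ BQ uM0 uM1 uN0 uN1 uI0 uI1 uJ0 uJ1 uQ0 uQ1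
    hBL hBM hBN hBI hBJ hBQ hM0 hM1 hN0 hN1 hI0 hI1 hJ0 hJ1 hQ0 hQ1
  have := h℘.isPrime
  have z {ι κ : Type} := LocElemSpec.matrix_zero (P := P) (℘ := ℘) (S := S) (Sα := Sα)
    (ι := ι) (κ := κ)
  have e {ι : Type} [DecidableEq ι] := LocElemSpec.matrix_one (P := P) (℘ := ℘) (S := S)
    (Sα := Sα) (ι := ι)
  refine ⟨cM ℘ h℘ Sα _ _ _ _ hM0 hBM hBL hM1, cN ℘ h℘ Sα _ _ _ _ hN0 hBN hBL hN1,
    cI ℘ h℘ Sα _ _ _ _ hI0 hBI hBL hI1, cJ ℘ h℘ Sα _ _ _ _ hJ0 hBJ hBL hJ1,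
    cQ ℘ h℘ Sα _ _ _ _ hQ0 hBL hBQ hQ1,
    cokerMap_injective (jM ℘ h℘ Sα _ _ _ (.fromCols hM0 hBL) (.fromCols e z) hBM),
    cokerMap_injective (jN ℘ h℘ Sα _ _ _ (.fromCols hN0 hBL) (.fromCols e z) hBN),
    cokerMap_injective (jI ℘ h℘ Sα _ _ _ (.fromCols hI0 hBL) (.fromCols e z) hBI),
    cokerMap_injective (jJ ℘ h℘ Sα _ _ _ (.fromCols hJ0 hBL) (.fromCols e z) hBJ),
    le_antisymm (le_inf
      (range_cokerMap_le (IM ℘ h℘ Sα _ _ _ z hI0 (.fromCols hM0 hBL)))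
      (range_cokerMap_le (IN ℘ h℘ Sα _ _ _ z hI0 (.fromCols hN0 hBL))))
      (inf_range_cokerMap_le (MNI ℘ h℘ Sα _ _ _ (.fromCols (.fromCols hM0 hN0) hBL)
        (.fromCols (.fromCols hM0 z) z) (.fromCols hI0 hBL))),
    le_antisymm
      (range_cokerMap_le_sup (JMN ℘ h℘ Sα _ _ _ z hJ0 (.fromCols (.fromCols hM0 hN0) hBL)))
      (sup_le (range_cokerMap_le (MJ ℘ h℘ Sα _ _ _ z hM0 (.fromCols hJ0 hBL)))
        (range_cokerMap_le (NJ ℘ h℘ Sα _ _ _ z hN0 (.fromCols hJ0 hBL)))),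
    cokerMap_surjective (qs ℘ h℘ Sα _ _ _ z e (.fromCols hQ0 hBQ)),
    le_antisymm
      (ker_cokerMap_le (qM ℘ h℘ Sα _ _ _ (.fromCols hQ0 hBQ) (.fromCols e z)
        (.fromCols hM0 hBL)))
      (range_cokerMap_le_ker (Mq ℘ h℘ Sα _ _ _ (.fromCols e hM0) (.fromCols hQ0 z) hBQ))⟩

end Spl
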